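/- Consider the rotating Kepler problem, the μ = 0 limit of the PCR3BP: q̈₁ − 2q̇₂ = −∂V₀/∂q₁, q̈₂ + 2q̇₁ = −∂V₀/∂q₂ on ℝ² \ {0}, where V₀(q) = −‖q‖²/2 − 1/‖q‖. Let c < −3/2 (the unique critical value of V₀) and let q : (0, T) → ℝ² \ {0} be a maximal C² solution with energy ‖q̇‖²/2 + V₀(q) ≡ c that ejects from collision, i.e. lim_{t→0⁺} q(t) = 0. Then T < ∞ and lim_{t→T⁻} q(t) = 0; that is, every ejection orbit of the rotating Kepler problem at such an energy is a consecutive collision orbit. -/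

import Mathlib

open Set Filter

/-- Euclidean norm on `ℝ × ℝ`. -/
noncomputable def nrm (v : ℝ × ℝ) : ℝ := Real.sqrt (v.1 ^ 2 + v.2 ^ 2)

/-- Effective potential of the rotating Kepler problem (the `μ = 0` limit of the
PCR3BP): `V₀(q) = -‖q‖²/2 - 1/‖q‖` on `ℝ² \ {0}`. -/
noncomputable def V0 (q : ℝ × ℝ) : ℝ := -(nrm q ^ 2 / 2) - 1 / nrm q

/-- The time domain `(0, T)` for a possibly infinite final time `T ∈ (0, ∞]`. -/
def timeDom (T : EReal) : Set ℝ := {t : ℝ | 0 < t ∧ (t : EReal) < T}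

/-- An ejection solution of the rotating Kepler problem with energy `c` on `(0,T)`:
a `C²` solution of `q̈₁ - 2q̇₂ = -∂V₀/∂q₁`, `q̈₂ + 2q̇₁ = -∂V₀/∂q₂` in `ℝ² \ {0}` with
energy `c` that ejects from collision, `lim_{t→0⁺} q(t) = 0`. -/
def IsEjectionSol (c : ℝ) (T : EReal) (q q' q'' : ℝ → ℝ × ℝ) : Prop :=
  (∀ t ∈ timeDom T, q t ≠ (0, 0)) ∧
  (∀ t ∈ timeDom T, HasDerivAt q (q' t) t) ∧
  (∀ t ∈ timeDom T, HasDerivAt q' (q'' t) t) ∧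
  ContinuousOn q'' (timeDom T) ∧
  (∀ t ∈ timeDom T,
    (q'' t).1 - 2 * (q' t).2 = -((fderiv ℝ V0 (q t)) (1, 0)) ∧
    (q'' t).2 + 2 * (q' t).1 = -((fderiv ℝ V0 (q t)) (0, 1))) ∧
  (∀ t ∈ timeDom T, nrm (q' t) ^ 2 / 2 + V0 (q t) = c) ∧
  Tendsto q (nhdsWithin 0 (Ioi 0)) (nhds (0, 0))

open Topology

section Calculus

variable {E : Type*} [NormedAddCommGroup E] [NormedSpace ℝ E]

theorem HasDerivAt.fst_comp {F : Type*} [NormedAddCommGroup F] [NormedSpace ℝ F]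
    {f : ℝ → E × F} {f' : E × F} {t : ℝ} (h : HasDerivAt f f' t) :
    HasDerivAt (fun s => (f s).1) f'.1 t :=
  (hasFDerivAt_fst (𝕜 := ℝ) (p := f t)).comp_hasDerivAt t h

theorem HasDerivAt.snd_comp {F : Type*} [NormedAddCommGroup F] [NormedSpace ℝ F]
    {f : ℝ → E × F} {f' : E × F} {t : ℝ} (h : HasDerivAt f f' t) :
    HasDerivAt (fun s => (f s).2) f'.2 t :=
  (hasFDerivAt_snd (𝕜 := ℝ) (p := f t)).comp_hasDerivAt t h

theorem sub_le_mul_sub_of_hasDerivAt_le {s : Set ℝ} (hs : IsOpen s) (hc : Convex ℝ s)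
    {f f' : ℝ → ℝ} {C : ℝ} (hf : ∀ t ∈ s, HasDerivAt f (f' t) t) (hC : ∀ t ∈ s, f' t ≤ C)
    {x y : ℝ} (hx : x ∈ s) (hy : y ∈ s) (hxy : x ≤ y) : f y - f x ≤ C * (y - x) := by
  refine hc.image_sub_le_mul_sub_of_deriv_le
    (fun t ht => (hf t ht).continuousAt.continuousWithinAt) ?_ ?_ x hx y hy hxy
  · rw [hs.interior_eq]
    exact fun t ht => (hf t ht).differentiableAt.differentiableWithinAt
  · rw [hs.interior_eq]
    intro t ht
    rw [(hf t ht).deriv]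
    exact hC t ht

theorem eq_of_hasDerivAt_zero {s : Set ℝ} (hs : IsOpen s) (hc : Convex ℝ s) {f : ℝ → E}
    (hf : ∀ t ∈ s, HasDerivAt f 0 t) {x y : ℝ} (hx : x ∈ s) (hy : y ∈ s) : f x = f y :=
  hs.is_const_of_deriv_eq_zero hc.isPreconnected
    (fun t ht => (hf t ht).differentiableAt.differentiableWithinAt)
    (fun t ht => (hf t ht).deriv) hx hy

/-- A function on `(a, b)` that is bounded below and whose derivative is bounded above has a
limit at `b`. -/
theorem exists_tendsto_nhdsLT_of_hasDerivAt_le {f f' : ℝ → ℝ} {a b m C : ℝ} (hab : a < b)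
    (hf : ∀ t ∈ Ioo a b, HasDerivAt f (f' t) t) (hC : ∀ t ∈ Ioo a b, f' t ≤ C)
    (hm : ∀ t ∈ Ioo a b, m ≤ f t) : ∃ l, Tendsto f (𝓝[<] b) (𝓝 l) := by
  have hmono : MonotoneOn (fun t => C * t - f t) (Ioo a b) := by
    intro x hx y hy hxy
    have := sub_le_mul_sub_of_hasDerivAt_le isOpen_Ioo (convex_Ioo a b) hf hC hx hy hxy
    simp only
    linarith
  have hbdd : BddAbove ((fun t => C * t - f t) '' Ioo a b) := by
    refine ⟨|C| * (|a| + |b|) - m, ?_⟩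
    rintro _ ⟨t, ht, rfl⟩
    have h1 : |t| ≤ |a| + |b| := by
      refine abs_le.2 ⟨?_, ?_⟩
      · linarith [ht.1, neg_abs_le a, abs_nonneg b]
      · linarith [ht.2, le_abs_self b, abs_nonneg a]
    have h2 : C * t ≤ |C| * (|a| + |b|) :=
      (le_abs_self _).trans (by rw [abs_mul]; gcongr)
    have := hm t ht
    simp only
    linarith
  have h := hmono.tendsto_nhdsWithin_Ioo_left (nonempty_Ioo.2 hab) hbdd
  have hlin : Tendsto (fun t : ℝ => C * t) (𝓝[<] b) (𝓝 (C * b)) :=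
    ((continuous_const.mul continuous_id).tendsto b).mono_left nhdsWithin_le_nhds
  refine ⟨_, (hlin.sub h).congr fun t => ?_⟩
  ring

/-- A function on `(a, b)` with bounded derivative has a limit at `b`. -/
theorem exists_tendsto_nhdsLT_of_norm_hasDerivAt_le [CompleteSpace E] {f f' : ℝ → E} {a b C : ℝ}
    (hab : a < b) (hf : ∀ t ∈ Ioo a b, HasDerivAt f (f' t) t)
    (hC : ∀ t ∈ Ioo a b, ‖f' t‖ ≤ C) : ∃ l, Tendsto f (𝓝[<] b) (𝓝 l) := by
  have hlip : LipschitzOnWith C.toNNReal f (Ioo a b) :=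
    (convex_Ioo a b).lipschitzOnWith_of_nnnorm_hasDerivWithin_le
      (fun t ht => (hf t ht).hasDerivWithinAt)
      (fun t ht => NNReal.le_toNNReal_of_coe_le (hC t ht))
  have hcau : Cauchy (map f (𝓝[<] b)) :=
    (cauchy_nhds.mono nhdsWithin_le_nhds).map_of_le hlip.uniformContinuousOn
      (le_principal_iff.2 (Ioo_mem_nhdsLT hab))
  exact CompleteSpace.complete hcau

/-- A solution of an autonomous equation on `(a, b)` that converges, as `t → b`, to a point where
the vector field is `C¹` extends beyond `b`. -/
theorem exists_extension_of_tendsto [CompleteSpace E] {F : E → E} {x : ℝ → E} {a b : ℝ}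
    (hab : a < b) (hx : ∀ t ∈ Ioo a b, HasDerivAt x (F (x t)) t) {p : E}
    (hp : Tendsto x (𝓝[<] b) (𝓝 p)) (hF : ContDiffAt ℝ 1 F p) {U : Set E} (hU : U ∈ 𝓝 p) :
    ∃ ε > 0, ∃ y : ℝ → E, (∀ t < b, y t = x t) ∧
      (∀ t ∈ Ioo a (b + ε), HasDerivAt y (F (y t)) t) ∧ ∀ t ∈ Ico b (b + ε), y t ∈ U := by
  obtain ⟨α, hα, δ, hδ, hα'⟩ :=
    hF.exists_forall_mem_closedBall_exists_eq_forall_mem_Ioo_hasDerivAt₀ b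
  have hαb := hα' b ⟨by linarith, by linarith⟩
  obtain ⟨η, hη, hηU⟩ := Metric.mem_nhds_iff.1 (hαb.continuousAt.preimage_mem_nhds
    (by rwa [hα] : U ∈ 𝓝 (α b)))
  set y : ℝ → E := fun t => if t < b then x t else α t with hy
  have hlt : ∀ t < b, y t = x t := fun t ht => if_pos ht
  have hge : ∀ t, b ≤ t → y t = α t := fun t ht => if_neg ht.not_gt
  have hyb : y b = p := by rw [hge b le_rfl, hα]
  have hx_eq : ∀ t < b, y =ᶠ[𝓝 t] x := fun t ht => by
    filter_upwards [Iio_mem_nhds ht] with s hs using hlt s hs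
  have hleft : ∀ t ∈ Ioo a b, HasDerivAt y (F (y t)) t := fun t ht => by
    rw [hlt t ht.2]
    exact (hx t ht).congr_of_eventuallyEq (hx_eq t ht.2)
  have hytend : Tendsto y (𝓝[<] b) (𝓝 p) := hp.congr' (by
    filter_upwards [self_mem_nhdsWithin] with s hs using (hlt s hs).symm)
  have hb : HasDerivAt y (F (y b)) b := by
    have h1 : HasDerivWithinAt y (F (y b)) (Iic b) b := by
      refine hasDerivWithinAt_Iic_of_tendsto_deriv (s := Ioo a b)
        (fun t ht => (hleft t ht).differentiableAt.differentiableWithinAt) ?_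
        (Ioo_mem_nhdsLT hab) ?_
      · change Tendsto y _ _
        rw [hyb]
        exact hytend.mono_left (nhdsWithin_mono _ Ioo_subset_Iio_self)
      · rw [hyb]
        refine (hF.continuousAt.tendsto.comp hytend).congr' ?_
        filter_upwards [Ioo_mem_nhdsLT hab] with s hs using (hleft s hs).deriv.symm
    have h2 : HasDerivWithinAt y (F (y b)) (Ici b) b := by
      rw [hge b le_rfl]
      exact hαb.hasDerivWithinAt.congr (fun s hs => hge s hs) (hge b le_rfl)
    have := h1.union h2
    rwa [Iic_union_Ici, hasDerivWithinAt_univ] at this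
  refine ⟨min δ η, lt_min hδ hη, y, hlt, fun t ht => ?_, fun t ht => ?_⟩
  · rcases lt_trichotomy t b with h | rfl | h
    · exact hleft t ⟨ht.1, h⟩
    · exact hb
    · have hy_eq : y =ᶠ[𝓝 t] α := by
        filter_upwards [Ioi_mem_nhds h] with s hs using hge s (le_of_lt hs)
      rw [hge t h.le]
      exact (hα' t ⟨by linarith, by linarith [ht.2, min_le_left δ η]⟩).congr_of_eventuallyEq hy_eq
  · rw [hge t ht.1]
    refine hηU ?_
    rw [Metric.mem_ball, Real.dist_eq, abs_lt]
    exact ⟨by linarith [ht.1], by linarith [ht.2, min_le_right δ η]⟩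

end Calculus

theorem isOpen_timeDom (T : EReal) : IsOpen (timeDom T) :=
  isOpen_Ioi.inter (isOpen_Iio.preimage continuous_coe_real_ereal)

theorem convex_timeDom (T : EReal) : Convex ℝ (timeDom T) := by
  refine Set.OrdConnected.convex ⟨fun x hx y hy z hz => ⟨hx.1.trans_le hz.1, ?_⟩⟩
  exact lt_of_le_of_lt (EReal.coe_le_coe_iff.2 hz.2) hy.2

theorem timeDom_coe (b : ℝ) : timeDom (b : EReal) = Ioo 0 b := by
  ext t
  simp [timeDom]

theorem timeDom_mem_nhdsGT {T : EReal} (hT : 0 < T) : timeDom T ∈ 𝓝[>] (0 : ℝ) := by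
  have h : {t : ℝ | (t : EReal) < T} ∈ 𝓝 (0 : ℝ) :=
    (isOpen_Iio.preimage continuous_coe_real_ereal).mem_nhds (by simpa using hT)
  filter_upwards [self_mem_nhdsWithin, mem_nhdsWithin_of_mem_nhds h] with t h1 h2 using ⟨h1, h2⟩

section Nrm

variable (v : ℝ × ℝ)

theorem nrm_nonneg : 0 ≤ nrm v := Real.sqrt_nonneg _

theorem nrm_sq : nrm v ^ 2 = v.1 ^ 2 + v.2 ^ 2 := Real.sq_sqrt (by positivity)

theorem abs_fst_le_nrm : |v.1| ≤ nrm v :=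
  Real.abs_le_sqrt (by nlinarith [sq_nonneg v.2])

theorem abs_snd_le_nrm : |v.2| ≤ nrm v :=
  Real.abs_le_sqrt (by nlinarith [sq_nonneg v.1])

variable {v}

theorem sq_add_sq_pos (hv : v ≠ (0, 0)) : 0 < v.1 ^ 2 + v.2 ^ 2 := by
  rcases ne_or_eq v.1 0 with h | h
  · positivity
  · have h2 : v.2 ≠ 0 := fun h2 => hv (Prod.ext h h2)
    positivity

theorem nrm_pos (hv : v ≠ (0, 0)) : 0 < nrm v := Real.sqrt_pos.2 (sq_add_sq_pos hv)

theorem continuous_nrm : Continuous nrm := by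
  unfold nrm
  fun_prop

theorem norm_le_nrm : ‖v‖ ≤ nrm v :=
  max_le (abs_fst_le_nrm v) (abs_snd_le_nrm v)

theorem hasFDerivAt_sq_add_sq (v : ℝ × ℝ) :
    HasFDerivAt (fun w : ℝ × ℝ => w.1 ^ 2 + w.2 ^ 2)
      ((2 * v.1) • ContinuousLinearMap.fst ℝ ℝ ℝ + (2 * v.2) • ContinuousLinearMap.snd ℝ ℝ ℝ) v := by
  have h1 := (hasFDerivAt_fst (𝕜 := ℝ) (p := v)).pow 2
  have h2 := (hasFDerivAt_snd (𝕜 := ℝ) (p := v)).pow 2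
  convert! h1.add h2 using 1
  ext <;> simp

theorem hasFDerivAt_V0 (hv : v ≠ (0, 0)) :
    HasFDerivAt V0 ((-(1 / 2) + 1 / (2 * nrm v ^ 3)) •
      ((2 * v.1) • ContinuousLinearMap.fst ℝ ℝ ℝ
        + (2 * v.2) • ContinuousLinearMap.snd ℝ ℝ ℝ)) v := by
  have hr := nrm_pos hv
  have hφ : HasDerivAt (fun u : ℝ => -(u / 2) - 1 / Real.sqrt u)
      (-(1 / 2) + 1 / (2 * nrm v ^ 3)) (v.1 ^ 2 + v.2 ^ 2) := by
    have h1 := ((hasDerivAt_id (v.1 ^ 2 + v.2 ^ 2)).div_const 2).neg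
    have h2 := (Real.hasDerivAt_sqrt (sq_add_sq_pos hv).ne').inv hr.ne'
    convert! h1.sub h2 using 1
    · ext u
      simp
    · change _ = -(1 / 2) - -(1 / (2 * nrm v)) / nrm v ^ 2
      field_simp
      ring
  have h := hφ.comp_hasFDerivAt v (hasFDerivAt_sq_add_sq v)
  convert! h using 1
  ext w
  simp [V0, ← nrm_sq, Real.sqrt_sq (nrm_nonneg w)]

theorem fderiv_V0_apply (hv : v ≠ (0, 0)) (w : ℝ × ℝ) :
    fderiv ℝ V0 v w = -(v.1 - v.1 / nrm v ^ 3) * w.1 - (v.2 - v.2 / nrm v ^ 3) * w.2 := by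
  have hr := nrm_pos hv
  rw [(hasFDerivAt_V0 hv).fderiv]
  simp
  field_simp
  ring

end Nrm

/-- The acceleration of the rotating Kepler problem at position `x` with velocity `v`. -/
noncomputable def keplerAcc (x v : ℝ × ℝ) : ℝ × ℝ :=
  (2 * v.2 + x.1 - x.1 / nrm x ^ 3, -2 * v.1 + x.2 - x.2 / nrm x ^ 3)

theorem eq_keplerAcc_iff {x v w : ℝ × ℝ} (hx : x ≠ (0, 0)) :
    w = keplerAcc x v ↔ w.1 - 2 * v.2 = -(fderiv ℝ V0 x (1, 0)) ∧
      w.2 + 2 * v.1 = -(fderiv ℝ V0 x (0, 1)) := by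
  rw [fderiv_V0_apply hx, fderiv_V0_apply hx, Prod.ext_iff]
  simp only [keplerAcc]
  constructor
  · rintro ⟨h1, h2⟩
    constructor <;> linarith
  · rintro ⟨h1, h2⟩
    constructor <;> linarith

theorem contDiffAt_keplerField {p : (ℝ × ℝ) × (ℝ × ℝ)} (hp : p.1 ≠ (0, 0)) :
    ContDiffAt ℝ 1 (fun z : (ℝ × ℝ) × (ℝ × ℝ) => (z.2, keplerAcc z.1 z.2)) p := by
  have hsq := (sq_add_sq_pos hp).ne'
  have hn : ContDiffAt ℝ 1 (fun z : (ℝ × ℝ) × (ℝ × ℝ) => nrm z.1) p := by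
    unfold nrm
    exact ContDiffAt.sqrt (by fun_prop) hsq
  have hr : nrm p.1 ^ 3 ≠ 0 := (pow_pos (nrm_pos hp) 3).ne'
  unfold keplerAcc
  fun_prop (disch := assumption)

theorem norm_keplerAcc_le {x v : ℝ × ℝ} {δ R M : ℝ} (hδ : 0 < δ) (hδx : δ ≤ nrm x)
    (hR : nrm x ≤ R) (hM : nrm v ≤ M) : ‖keplerAcc x v‖ ≤ 2 * M + R + 1 / δ ^ 2 := by
  have hr : 0 < nrm x := hδ.trans_le hδx
  have key : ∀ a : ℝ, |a| ≤ nrm x → |a / nrm x ^ 3| ≤ 1 / δ ^ 2 := by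
    intro a ha
    rw [abs_div, abs_of_pos (pow_pos hr 3)]
    calc |a| / nrm x ^ 3 ≤ nrm x / nrm x ^ 3 := by gcongr
      _ = 1 / nrm x ^ 2 := by field_simp
      _ ≤ 1 / δ ^ 2 := by gcongr
  have h1 := abs_le.1 (key _ (abs_fst_le_nrm x))
  have h2 := abs_le.1 (key _ (abs_snd_le_nrm x))
  have h3 := abs_le.1 (abs_fst_le_nrm x)
  have h4 := abs_le.1 (abs_snd_le_nrm x)
  have h5 := abs_le.1 (abs_fst_le_nrm v)
  have h6 := abs_le.1 (abs_snd_le_nrm v)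
  refine max_le (abs_le.2 ⟨?_, ?_⟩) (abs_le.2 ⟨?_, ?_⟩) <;> simp only [keplerAcc] <;> linarith

section Conservation

variable {q v : ℝ → ℝ × ℝ} {t : ℝ}

theorem HasDerivAt.nrm_comp {w : ℝ × ℝ} (h0 : q t ≠ (0, 0)) (hq : HasDerivAt q w t) :
    HasDerivAt (fun s => nrm (q s)) (((q t).1 * w.1 + (q t).2 * w.2) / nrm (q t)) t := by
  have h := ((hasFDerivAt_sq_add_sq (q t)).comp_hasDerivAt t hq).sqrt (sq_add_sq_pos h0).ne'
  convert! h using 1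
  change _ = _ / (2 * nrm (q t))
  have := nrm_pos h0
  simp
  field_simp

theorem hasDerivAt_energy (h0 : q t ≠ (0, 0)) (hq : HasDerivAt q (v t) t)
    (hv : HasDerivAt v (keplerAcc (q t) (v t)) t) :
    HasDerivAt (fun s => nrm (v s) ^ 2 / 2 + V0 (q s)) 0 t := by
  have hr := nrm_pos h0
  have h1 := (((hasFDerivAt_sq_add_sq (v t)).comp_hasDerivAt t hv).div_const 2).add
    ((hasFDerivAt_V0 h0).comp_hasDerivAt t hq)
  convert! h1 using 1
  · ext s
    simp [nrm_sq]
  · simp [keplerAcc]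
    field_simp
    ring

theorem hasDerivAt_angularMomentum (h0 : q t ≠ (0, 0)) (hq : HasDerivAt q (v t) t)
    (hv : HasDerivAt v (keplerAcc (q t) (v t)) t) :
    HasDerivAt (fun s => (q s).1 * (v s).2 - (q s).2 * (v s).1 + nrm (q s) ^ 2) 0 t := by
  have hr := nrm_pos h0
  have h := ((hq.fst_comp.mul hv.snd_comp).sub (hq.snd_comp.mul hv.fst_comp)).add
    ((hasFDerivAt_sq_add_sq (q t)).comp_hasDerivAt t hq)
  convert! h using 1
  · ext s
    simp [nrm_sq]
  · simp [keplerAcc]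
    ring

theorem hasDerivAt_radialVelocity (h0 : q t ≠ (0, 0)) (hq : HasDerivAt q (v t) t)
    (hv : HasDerivAt v (keplerAcc (q t) (v t)) t)
    (hL : (q t).1 * (v t).2 - (q t).2 * (v t).1 + nrm (q t) ^ 2 = 0) :
    HasDerivAt (fun s => ((q s).1 * (v s).1 + (q s).2 * (v s).2) / nrm (q s))
      (-(1 / nrm (q t) ^ 2)) t := by
  have hr := nrm_pos h0
  have h := ((hq.fst_comp.mul hv.fst_comp).add (hq.snd_comp.mul hv.snd_comp)).div
    (hq.nrm_comp h0) hr.ne'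
  convert! h using 1
  have hs := nrm_sq (q t)
  simp only [keplerAcc, Pi.add_apply, Pi.mul_apply]
  generalize nrm (q t) = r at *
  generalize (q t).1 = x at *
  generalize (q t).2 = y at *
  generalize (v t).1 = a at *
  generalize (v t).2 = b at *
  have hrad : (x * a + y * b) ^ 2 = r ^ 2 * (a ^ 2 + b ^ 2) - r ^ 4 := by
    have h1 : x * b - y * a = -r ^ 2 := by linarith
    have h2 : (x * a + y * b) ^ 2 + (x * b - y * a) ^ 2 = (x ^ 2 + y ^ 2) * (a ^ 2 + b ^ 2) := by
      ring
    rw [h1, ← hs] at h2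
    linarith
  have hnum : a * a + x * (2 * b + x - x / r ^ 3) + (b * b + y * (-2 * a + y - y / r ^ 3))
      = a ^ 2 + b ^ 2 - r ^ 2 - 1 / r := by
    have h1 : x * (x / r ^ 3) + y * (y / r ^ 3) = 1 / r := by
      have : x * (x / r ^ 3) + y * (y / r ^ 3) = (x ^ 2 + y ^ 2) / r ^ 3 := by ring
      rw [this, ← hs]
      field_simp
    linear_combination 2 * hL - hs - h1
  have hq3 : (x * a + y * b) * ((x * a + y * b) / r) = r * (a ^ 2 + b ^ 2) - r ^ 3 := by
    rw [← mul_div_assoc, ← sq, hrad]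
    field_simp
  rw [hnum, hq3]
  field_simp
  ring

end Conservation

namespace IsEjectionSol

variable {c : ℝ} {T : EReal} {q q' q'' : ℝ → ℝ × ℝ} {t : ℝ}

theorem ne_zero (h : IsEjectionSol c T q q' q'') (ht : t ∈ timeDom T) : q t ≠ (0, 0) := h.1 t ht

theorem hasDerivAt (h : IsEjectionSol c T q q' q'') (ht : t ∈ timeDom T) :
    HasDerivAt q (q' t) t := h.2.1 t ht

theorem hasDerivAt_velocity (h : IsEjectionSol c T q q' q'') (ht : t ∈ timeDom T) :
    HasDerivAt q' (keplerAcc (q t) (q' t)) t := by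
  rw [← (eq_keplerAcc_iff (h.ne_zero ht)).2 (h.2.2.2.2.1 t ht)]
  exact h.2.2.1 t ht

theorem nrm_velocity_sq (h : IsEjectionSol c T q q' q'') (ht : t ∈ timeDom T) :
    nrm (q' t) ^ 2 = 2 * c + nrm (q t) ^ 2 + 2 / nrm (q t) := by
  have := h.2.2.2.2.2.1 t ht
  simp only [V0] at this
  linear_combination 2 * this

theorem tendsto_nrm (h : IsEjectionSol c T q q' q'') :
    Tendsto (fun s => nrm (q s)) (𝓝[>] 0) (𝓝 0) := by
  have := (continuous_nrm.tendsto (0, 0)).comp h.2.2.2.2.2.2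
  simpa [nrm] using! this

/-- The angular momentum is conserved, and it tends to zero at the ejection. -/
theorem angularMomentum_eq_zero (h : IsEjectionSol c T q q' q'') (ht : t ∈ timeDom T) :
    (q t).1 * (q' t).2 - (q t).2 * (q' t).1 + nrm (q t) ^ 2 = 0 := by
  have hT : 0 < T := lt_trans (by exact_mod_cast ht.1) ht.2
  obtain ⟨l, hl⟩ : ∃ l, l = (q t).1 * (q' t).2 - (q t).2 * (q' t).1 + nrm (q t) ^ 2 := ⟨_, rfl⟩
  have hconst : ∀ s ∈ timeDom T, (q s).1 * (q' s).2 - (q s).2 * (q' s).1 + nrm (q s) ^ 2 = l := by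
    intro s hs
    rw [hl]
    exact eq_of_hasDerivAt_zero (isOpen_timeDom T) (convex_timeDom T)
      (fun u hu => hasDerivAt_angularMomentum (h.ne_zero hu) (h.hasDerivAt hu)
        (h.hasDerivAt_velocity hu)) hs ht
  have hle : ∀ᶠ s in 𝓝[>] (0 : ℝ), (l - nrm (q s) ^ 2) ^ 2 ≤
      2 * c * nrm (q s) ^ 2 + nrm (q s) ^ 4 + 2 * nrm (q s) := by
    filter_upwards [timeDom_mem_nhdsGT hT] with s hs
    have hr := nrm_pos (h.ne_zero hs)
    have h1 : nrm (q s) ^ 2 * nrm (q' s) ^ 2 =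
        2 * c * nrm (q s) ^ 2 + nrm (q s) ^ 4 + 2 * nrm (q s) := by
      rw [h.nrm_velocity_sq hs]
      field_simp
    rw [← h1, ← hconst s hs, nrm_sq (q s), nrm_sq (q' s)]
    nlinarith [sq_nonneg ((q s).1 * (q' s).1 + (q s).2 * (q' s).2)]
  have hr0 := h.tendsto_nrm
  have h1 : Tendsto (fun s => (l - nrm (q s) ^ 2) ^ 2) (𝓝[>] 0) (𝓝 ((l - 0 ^ 2) ^ 2)) :=
    ((hr0.pow 2).const_sub l).pow 2
  have h2 : Tendsto (fun s => 2 * c * nrm (q s) ^ 2 + nrm (q s) ^ 4 + 2 * nrm (q s)) (𝓝[>] 0)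
      (𝓝 (2 * c * 0 ^ 2 + 0 ^ 4 + 2 * 0)) :=
    (((hr0.pow 2).const_mul (2 * c)).add (hr0.pow 4)).add (hr0.const_mul 2)
  have h3 : l ^ 2 ≤ 0 := by simpa using le_of_tendsto_of_tendsto h1 h2 hle
  rw [← hl]
  exact pow_eq_zero_iff two_ne_zero |>.1 (le_antisymm h3 (sq_nonneg l))

/-- Since the angular momentum vanishes, half the squared radial velocity is `c + 1 / r`; hence the
orbit is confined to a disc of radius `1 / (-c)`. -/
theorem neg_energy_le_one_div_nrm (h : IsEjectionSol c T q q' q'') (ht : t ∈ timeDom T) :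
    -c ≤ 1 / nrm (q t) := by
  have hr := nrm_pos (h.ne_zero ht)
  have hL := h.angularMomentum_eq_zero ht
  have h1 : (nrm (q t) ^ 2) ^ 2 ≤ nrm (q t) ^ 2 * nrm (q' t) ^ 2 := by
    have h2 : nrm (q t) ^ 2 = -((q t).1 * (q' t).2 - (q t).2 * (q' t).1) := by linarith
    calc (nrm (q t) ^ 2) ^ 2 = ((q t).1 * (q' t).2 - (q t).2 * (q' t).1) ^ 2 := by
          rw [h2, neg_sq]
      _ ≤ nrm (q t) ^ 2 * nrm (q' t) ^ 2 := by
          rw [nrm_sq, nrm_sq]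
          nlinarith [sq_nonneg ((q t).1 * (q' t).1 + (q t).2 * (q' t).2)]
  rw [sq, mul_le_mul_iff_right₀ (pow_pos hr 2), h.nrm_velocity_sq ht] at h1
  have h3 : 2 / nrm (q t) = 2 * (1 / nrm (q t)) := by ring
  linarith

/-- The radial velocity of the orbit. -/
noncomputable def radialVelocity (q q' : ℝ → ℝ × ℝ) (t : ℝ) : ℝ :=
  ((q t).1 * (q' t).1 + (q t).2 * (q' t).2) / nrm (q t)

theorem hasDerivAt_nrm (h : IsEjectionSol c T q q' q'') (ht : t ∈ timeDom T) :
    HasDerivAt (fun s => nrm (q s)) (radialVelocity q q' t) t :=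
  (h.hasDerivAt ht).nrm_comp (h.ne_zero ht)

theorem radialVelocity_sub_le (hc : c ≤ 0) (h : IsEjectionSol c T q q' q'') {s : ℝ}
    (hs : s ∈ timeDom T) (ht : t ∈ timeDom T) (hst : s ≤ t) :
    radialVelocity q q' t - radialVelocity q q' s ≤ -c ^ 2 * (t - s) := by
  refine sub_le_mul_sub_of_hasDerivAt_le (isOpen_timeDom T) (convex_timeDom T)
    (fun u hu => hasDerivAt_radialVelocity (h.ne_zero hu) (h.hasDerivAt hu)
      (h.hasDerivAt_velocity hu) (h.angularMomentum_eq_zero hu)) (fun u hu => ?_) hs ht hst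
  have h1 := h.neg_energy_le_one_div_nrm hu
  have h2 : 1 / nrm (q u) ^ 2 = (1 / nrm (q u)) ^ 2 := by ring
  rw [h2]
  nlinarith

/-- The radius is a positive function with second derivative at most `-c ^ 2 < 0`, so that it
cannot be defined for all positive times. -/
theorem lt_top (hc : c < 0) (h : IsEjectionSol c T q q' q'') : T < ⊤ := by
  refine lt_top_iff_ne_top.2 fun hT => ?_
  subst hT
  have hmem : ∀ s : ℝ, 0 < s → s ∈ timeDom ⊤ := fun s hs => ⟨hs, EReal.coe_lt_top s⟩
  have hc2 : 0 < c ^ 2 := sq_pos_of_neg hc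
  obtain ⟨a, ha⟩ : ∃ a, 1 + (|radialVelocity q q' 1| + 1) / c ^ 2 = a := ⟨_, rfl⟩
  have ha1 : 1 ≤ a := by
    rw [← ha]
    have : 0 ≤ (|radialVelocity q q' 1| + 1) / c ^ 2 := by positivity
    linarith
  have hinward : ∀ s ∈ Ioi a, radialVelocity q q' s ≤ -1 := by
    intro s hs
    have h1 := h.radialVelocity_sub_le hc.le (hmem 1 one_pos)
      (hmem s (by linarith [mem_Ioi.1 hs])) (by linarith [mem_Ioi.1 hs])
    have h2 : (|radialVelocity q q' 1| + 1) / c ^ 2 ≤ s - 1 := by linarith [mem_Ioi.1 hs]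
    rw [div_le_iff₀ hc2] at h2
    linarith [le_abs_self (radialVelocity q q' 1)]
  have hpos := nrm_nonneg (q (a + 1 + (nrm (q (a + 1)) + 1)))
  have hn := nrm_nonneg (q (a + 1))
  have h1 := sub_le_mul_sub_of_hasDerivAt_le isOpen_Ioi (convex_Ioi a)
    (fun s hs => h.hasDerivAt_nrm (hmem s (by linarith [mem_Ioi.1 hs]))) hinward
    (x := a + 1) (y := a + 1 + (nrm (q (a + 1)) + 1)) (by simp)
    (by simp only [mem_Ioi]; linarith) (by linarith)
  linarith

theorem exists_tendsto_nrm (hc : c ≤ 0) {b : ℝ} (hb : 0 < b)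
    (h : IsEjectionSol c b q q' q'') : ∃ l, Tendsto (fun s => nrm (q s)) (𝓝[<] b) (𝓝 l) := by
  have hmem : ∀ s ∈ Ico (b / 2) b, s ∈ timeDom (b : EReal) := fun s hs => by
    rw [timeDom_coe]
    exact ⟨by linarith [hs.1], hs.2⟩
  refine exists_tendsto_nhdsLT_of_hasDerivAt_le (a := b / 2) (by linarith)
    (fun s hs => h.hasDerivAt_nrm (hmem s (Ioo_subset_Ico_self hs)))
    (C := radialVelocity q q' (b / 2)) (fun s hs => ?_) (m := 0) (fun s _ => nrm_nonneg _)
  have := h.radialVelocity_sub_le hc (hmem (b / 2) ⟨le_rfl, by linarith⟩)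
    (hmem s (Ioo_subset_Ico_self hs)) hs.1.le
  nlinarith [sq_nonneg c, hs.1]

/-- If the radius does not tend to zero at the final time, then position and velocity converge to
a point away from the collision. -/
theorem exists_tendsto_state (hc : c < 0) {b l : ℝ} (hb : 0 < b)
    (h : IsEjectionSol c b q q' q'') (hl : 0 < l)
    (hlim : Tendsto (fun s => nrm (q s)) (𝓝[<] b) (𝓝 l)) :
    ∃ p : (ℝ × ℝ) × (ℝ × ℝ), p.1 ≠ (0, 0) ∧
      Tendsto (fun s => (q s, q' s)) (𝓝[<] b) (𝓝 p) := by
  obtain ⟨a, hab, ha⟩ : ∃ a ∈ Iio b, Ioo a b ⊆ {s | l / 2 < nrm (q s)} :=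
    mem_nhdsLT_iff_exists_Ioo_subset.1 (hlim.eventually (lt_mem_nhds (half_lt_self hl)))
  obtain ⟨a', ha'⟩ : ∃ a', max a 0 = a' := ⟨_, rfl⟩
  have hab' : a' < b := ha' ▸ max_lt hab hb
  have hmem : ∀ s ∈ Ioo a' b, s ∈ timeDom (b : EReal) := fun s hs => by
    rw [timeDom_coe]
    exact ⟨((le_max_right a 0).trans_eq ha').trans_lt hs.1, hs.2⟩
  have hlow : ∀ s ∈ Ioo a' b, l / 2 < nrm (q s) := fun s hs =>
    ha ⟨((le_max_left a 0).trans_eq ha').trans_lt hs.1, hs.2⟩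
  have hup : ∀ s ∈ Ioo a' b, nrm (q s) ≤ 1 / (-c) := fun s hs => by
    rw [le_div_comm₀ (by have := hlow s hs; linarith) (by linarith)]
    exact h.neg_energy_le_one_div_nrm (hmem s hs)
  obtain ⟨M, hM⟩ : ∃ M, √((1 / (-c)) ^ 2 + 4 / l) = M := ⟨_, rfl⟩
  have hvel : ∀ s ∈ Ioo a' b, nrm (q' s) ≤ M := fun s hs => by
    rw [← hM]
    refine Real.le_sqrt_of_sq_le ?_
    rw [h.nrm_velocity_sq (hmem s hs)]
    have h1 : nrm (q s) ^ 2 ≤ (1 / (-c)) ^ 2 :=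
      pow_le_pow_left₀ (nrm_nonneg _) (hup s hs) 2
    have h2 : 2 / nrm (q s) ≤ 2 / (l / 2) := by
      have := hlow s hs
      gcongr
    have h3 : 2 / (l / 2) = 4 / l := by
      field_simp
      norm_num
    linarith
  obtain ⟨p, hp⟩ := exists_tendsto_nhdsLT_of_norm_hasDerivAt_le (f := fun s => (q s, q' s)) hab'
    (fun s hs => (h.hasDerivAt (hmem s hs)).prodMk (h.hasDerivAt_velocity (hmem s hs)))
    (C := max M (2 * M + 1 / (-c) + 1 / (l / 2) ^ 2))
    (fun s hs => max_le_max (norm_le_nrm.trans (hvel s hs))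
      (norm_keplerAcc_le (half_pos hl) (hlow s hs).le (hup s hs) (hvel s hs)))
  refine ⟨p, fun hp0 => ?_, hp⟩
  have h1 := ((continuous_nrm.comp continuous_fst).tendsto p).comp hp
  have h2 := tendsto_nhds_unique h1 hlim
  simp [hp0, nrm] at h2
  exact hl.ne h2

theorem exists_extension {b : ℝ} (hb : 0 < b) (h : IsEjectionSol c b q q' q'')
    {p : (ℝ × ℝ) × (ℝ × ℝ)} (hp0 : p.1 ≠ (0, 0))
    (hp : Tendsto (fun s => (q s, q' s)) (𝓝[<] b) (𝓝 p)) :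
    ∃ T' : EReal, b < T' ∧ ∃ Q Q' Q'' : ℝ → ℝ × ℝ,
      IsEjectionSol c T' Q Q' Q'' ∧ ∀ t ∈ timeDom b, Q t = q t := by
  have hmem : ∀ s ∈ Ioo 0 b, s ∈ timeDom (b : EReal) := fun s hs => by rwa [timeDom_coe]
  obtain ⟨ε, hε, y, hlt, hy, hyU⟩ := exists_extension_of_tendsto hb
    (F := fun z : (ℝ × ℝ) × (ℝ × ℝ) => (z.2, keplerAcc z.1 z.2))
    (fun s hs => (h.hasDerivAt (hmem s hs)).prodMk (h.hasDerivAt_velocity (hmem s hs))) hp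
    (contDiffAt_keplerField hp0)
    ((isOpen_ne.preimage continuous_fst).mem_nhds hp0)
  have hQ0 : ∀ t ∈ Ioo 0 (b + ε), (y t).1 ≠ (0, 0) := fun t ht => by
    rcases lt_or_ge t b with htb | htb
    · rw [hlt t htb]
      exact h.ne_zero (hmem t ⟨ht.1, htb⟩)
    · exact hyU t ⟨htb, ht.2⟩
  have hQ : ∀ t ∈ Ioo 0 (b + ε), HasDerivAt (fun s => (y s).1) (y t).2 t :=
    fun t ht => (hy t ht).fst_comp
  have hQ' : ∀ t ∈ Ioo 0 (b + ε),
      HasDerivAt (fun s => (y s).2) (keplerAcc (y t).1 (y t).2) t :=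
    fun t ht => (hy t ht).snd_comp
  refine ⟨(b + ε : ℝ), EReal.coe_lt_coe_iff.2 (by linarith), fun s => (y s).1, fun s => (y s).2,
    fun s => keplerAcc (y s).1 (y s).2, ?_, ?_⟩
  · rw [IsEjectionSol, timeDom_coe]
    refine ⟨hQ0, hQ, hQ', fun t ht => ?_, fun t ht => (eq_keplerAcc_iff (hQ0 t ht)).1 rfl,
      fun t ht => ?_, ?_⟩
    · exact ((contDiffAt_keplerField (hQ0 t ht)).continuousAt.snd.comp
        (hy t ht).continuousAt).continuousWithinAt
    · have hhalf : b / 2 ∈ Ioo 0 b := ⟨by linarith, by linarith⟩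
      have h1 := eq_of_hasDerivAt_zero isOpen_Ioo (convex_Ioo 0 (b + ε))
        (fun u hu => hasDerivAt_energy (hQ0 u hu) (hQ u hu) (hQ' u hu)) ht
        (⟨hhalf.1, by linarith⟩ : b / 2 ∈ Ioo 0 (b + ε))
      have h2 := h.2.2.2.2.2.1 _ (hmem _ hhalf)
      simp only [hlt _ hhalf.2] at h1
      exact h1.trans h2
    · refine h.2.2.2.2.2.2.congr' ?_
      filter_upwards [Ioo_mem_nhdsGT hb] with s hs
      rw [hlt s hs.2]
  · intro t ht
    rw [timeDom_coe] at ht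
    simp only [hlt t ht.2]

end IsEjectionSol

/-- In the rotating Kepler problem at energy `c < -3/2` (below the unique critical value
of `V₀`), every maximal ejection solution has finite final time `T` and limits to
collision as `t → T⁻`: every ejection orbit is a consecutive collision orbit. -/
theorem rotating_kepler_ejection_orbit_is_consecutive_collision_orbit
    (c : ℝ) (hc : c < -(3 / 2)) (T : EReal) (hT : 0 < T)
    (q q' q'' : ℝ → ℝ × ℝ) (hsol : IsEjectionSol c T q q' q'')
    (hmax : ¬ ∃ T' : EReal, T < T' ∧ ∃ Q Q' Q'' : ℝ → ℝ × ℝ,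
      IsEjectionSol c T' Q Q' Q'' ∧ ∀ t ∈ timeDom T, Q t = q t) :
    T < ⊤ ∧ Tendsto q (nhdsWithin T.toReal (Iio T.toReal)) (nhds (0, 0)) := by

  have hc0 : c < 0 := by linarith
  have hTtop := hsol.lt_top hc0
  refine ⟨hTtop, ?_⟩
  lift T to ℝ using ⟨hTtop.ne, (bot_lt_of_lt hT).ne'⟩
  rw [EReal.toReal_coe]
  have hb : 0 < T := EReal.coe_pos.1 hT
  obtain ⟨l, hl⟩ := hsol.exists_tendsto_nrm hc0.le hb
  have hl0 : 0 ≤ l := ge_of_tendsto' hl fun s => nrm_nonneg _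
  rcases hl0.eq_or_lt with rfl | hlpos
  · exact squeeze_zero_norm (fun s => norm_le_nrm) hl
  · obtain ⟨p, hp0, hp⟩ := hsol.exists_tendsto_state hc0 hb hlpos hl
    exact absurd (hsol.exists_extension hb hp0 hp) hmax
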